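/- arXiv:2510.24423 — 2 statements merged into one kernel-verified Lean document; each statement's English description precedes it below -/
import Mathlib

section
/- Let (X,d) be a Lorentzian metric space with no chronological boundary, and let γ : I → X be an isocausal curve with I = (a,b) or I = [0,b) (b ≤ ∞ allowed). Suppose there is a sequence b_k → b with b_k < b such that γ(b_k) → p for some p ∈ X. Then p is a future endpoint of γ, i.e. γ(t) → p as t → b⁻. The analogous statement holds for past endpoints. -/
open Filter Topology Set

variable {X : Type*}

/-- Axiom (ii) of a Lorentzian metric space, relative to a given topology `T`:
`d` is continuous and, for all `x y` and `ε > 0`, the set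
`I_ε ∩ (closure (I(x,y)) × closure (I(x,y)))` is compact. -/
def LMSAxiom2 (T : TopologicalSpace X) (d : X → X → ℝ) : Prop :=
  letI := T
  Continuous (fun p : X × X => d p.1 p.2) ∧
    ∀ x y : X, ∀ ε : ℝ, 0 < ε →
      IsCompact ({p : X × X | ε ≤ d p.1 p.2} ∩
        (closure {z : X | 0 < d x z ∧ 0 < d z y} ×ˢ closure {z : X | 0 < d x z ∧ 0 < d z y}))

/-- Lorentzian metric space (LMS): `d ≥ 0`, reverse triangle inequality,
axiom (ii) for the topology `T`, and `d` distinguishes points. -/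
def IsLMS (T : TopologicalSpace X) (d : X → X → ℝ) : Prop :=
  (∀ x y : X, 0 ≤ d x y) ∧
  (∀ x y z : X, 0 < d x y → 0 < d y z → d x y + d y z ≤ d x z) ∧
  LMSAxiom2 T d ∧
  (∀ x y : X, x ≠ y → ∃ z : X, d x z ≠ d y z ∨ d z x ≠ d z y)

/-- No chronological boundary: `I(X) = X`. -/
def NoBoundary (d : X → X → ℝ) : Prop :=
  ∀ x : X, (∃ p, 0 < d p x) ∧ (∃ q, 0 < d x q)

/-- Countably generated: some countable set `G` satisfies `I(G) = X`. -/
def CountablyGenerated (d : X → X → ℝ) : Prop :=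
  ∃ G : Set X, G.Countable ∧ ∀ x : X, (∃ p ∈ G, 0 < d p x) ∧ (∃ q ∈ G, 0 < d x q)

/-- The causal relation `J` defined from the Lorentzian distance. -/
def Jrel (d : X → X → ℝ) (x y : X) : Prop :=
  ∀ p : X, d p x ≤ d p y ∧ d y p ≤ d x p

/-- Strict causal relation: `x < y`. -/
def CausalLt (d : X → X → ℝ) (x y : X) : Prop :=
  Jrel d x y ∧ x ≠ y

/-- An isocausal curve with parameter domain `S`. -/
def IsIsocausalOn (T : TopologicalSpace X) (d : X → X → ℝ) (γ : ℝ → X) (S : Set ℝ) : Prop :=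
  letI := T
  ContinuousOn γ S ∧ ∀ s ∈ S, ∀ t ∈ S, s < t → CausalLt d (γ s) (γ t)

/-- A maximizing curve on the domain `S`. -/
def MaximizingOn (d : X → X → ℝ) (γ : ℝ → X) (S : Set ℝ) : Prop :=
  ∀ t ∈ S, ∀ t' ∈ S, ∀ t'' ∈ S, t < t' → t' < t'' →
    d (γ t) (γ t') + d (γ t') (γ t'') = d (γ t) (γ t'')

/-- A time function: continuous and strictly increasing on causal pairs. -/
def IsTimeFunction (T : TopologicalSpace X) (d : X → X → ℝ) (τ : X → ℝ) : Prop :=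
  letI := T
  Continuous τ ∧ ∀ x y : X, CausalLt d x y → τ x < τ y

/-- A function monotone on `S` converges along `l` as soon as it converges along a sequence
cofinal with `l`. -/
theorem MonotoneOn.tendsto_of_cofinal_seq {α β : Type*} [Preorder α] [LinearOrder β]
    [TopologicalSpace β] [OrderTopology β] {f : α → β} {S : Set α} (hf : MonotoneOn f S)
    {l : Filter α} (hS : S ∈ l) {u : ℕ → α} (huS : ∀ k, u k ∈ S)
    (hul : ∀ k, ∀ᶠ t in l, u k ≤ t) (hlu : ∀ᶠ t in l, ∀ᶠ k in atTop, t ≤ u k)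
    {L : β} (hL : Tendsto (fun k => f (u k)) atTop (𝓝 L)) : Tendsto f l (𝓝 L) := by
  refine tendsto_order.2 ⟨fun c hc => ?_, fun c hc => ?_⟩
  · obtain ⟨k, hk⟩ := (hL.eventually_const_lt hc).exists
    filter_upwards [hS, hul k] with t ht hkt
    exact hk.trans_le (hf (huS k) ht hkt)
  · filter_upwards [hS, hlu] with t ht htu
    obtain ⟨k, hk, htk⟩ := ((hL.eventually_lt_const hc).and htu).exists
    exact (hf ht (huS k) htk).trans_lt hk

/-- In a Lorentzian metric space without chronological boundary, a filter along which all the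
distance functions converge to their values at `p` converges to `p`. -/
theorem IsLMS.le_nhds_of_tendsto_dist [T : TopologicalSpace X] {d : X → X → ℝ}
    (h : IsLMS T d) (hnb : NoBoundary d) {l : Filter X} {p : X}
    (hl : ∀ x, Tendsto (fun y => d x y) l (𝓝 (d x p)))
    (hr : ∀ x, Tendsto (fun y => d y x) l (𝓝 (d p x))) : l ≤ 𝓝 p := by
  obtain ⟨-, htri, ⟨hcont, hcomp⟩, hdist⟩ := h
  have htrans : ∀ {x y z}, 0 < d x y → 0 < d y z → 0 < d x z := fun hxy hyz =>
    (add_pos hxy hyz).trans_le (htri _ _ _ hxy hyz)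
  obtain ⟨⟨q, hq⟩, ⟨r, hr'⟩⟩ := hnb p
  obtain ⟨o, ho⟩ := (hnb q).1
  have hK := (hcomp o r (d q p / 2) (half_pos hq)).image continuous_snd
  refine hK.le_nhds_of_unique_clusterPt ?_ fun c _ hc => ?_
  · filter_upwards [(hl q).eventually_const_lt (half_lt_self hq),
      (hr r).eventually_const_lt hr'] with y hqy hyr
    have hqy' : 0 < d q y := (half_pos hq).trans hqy
    exact ⟨(q, y), ⟨hqy.le, subset_closure ⟨ho, htrans hq hr'⟩,
      subset_closure ⟨htrans ho hqy', hyr⟩⟩, rfl⟩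
  · have : NeBot (𝓝 c ⊓ l) := hc
    by_contra hne
    obtain ⟨z, hz | hz⟩ := hdist c p hne
    · have hc' : Continuous fun y => d y z := hcont.comp (continuous_id.prodMk continuous_const)
      exact hz (tendsto_nhds_unique (hc'.continuousAt.mono_left inf_le_left)
        ((hr z).mono_left inf_le_right))
    · have hc' : Continuous fun y => d z y := hcont.comp (continuous_const.prodMk continuous_id)
      exact hz (tendsto_nhds_unique (hc'.continuousAt.mono_left inf_le_left)
        ((hl z).mono_left inf_le_right))

theorem IsIsocausalOn.monotoneOn_dist_left {T : TopologicalSpace X} {d : X → X → ℝ} {γ : ℝ → X}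
    {S : Set ℝ} (hγ : IsIsocausalOn T d γ S) (x : X) : MonotoneOn (fun t => d x (γ t)) S := by
  intro s hs t ht hst
  rcases hst.eq_or_lt with rfl | hst
  · exact le_rfl
  · exact ((hγ.2 s hs t ht hst).1 x).1

theorem IsIsocausalOn.antitoneOn_dist_right {T : TopologicalSpace X} {d : X → X → ℝ} {γ : ℝ → X}
    {S : Set ℝ} (hγ : IsIsocausalOn T d γ S) (x : X) : AntitoneOn (fun t => d (γ t) x) S := by
  intro s hs t ht hst
  rcases hst.eq_or_lt with rfl | hst
  · exact le_rfl
  · exact ((hγ.2 s hs t ht hst).1 x).2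

/-- In a Lorentzian metric space without chronological boundary, if an isocausal
curve `γ : I → X` (with `I = (a,b)` or `I = [0,b)`, `b ≤ ∞`) accumulates along a
sequence `b_k → b` at a point `p`, then `p` is a future endpoint of `γ`; and the
time-dual statement for past endpoints. -/
theorem lms_accumulation_is_endpoint
    (T : TopologicalSpace X) (d : X → X → ℝ)
    (h : IsLMS T d) (hnb : NoBoundary d) :
    (∀ (b : EReal) (S : Set ℝ),
      ((∃ a : ℝ, (a : EReal) < b ∧ S = {t : ℝ | a < t ∧ (t : EReal) < b}) ∨
        ((0 : EReal) < b ∧ S = {t : ℝ | 0 ≤ t ∧ (t : EReal) < b})) →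
      ∀ γ : ℝ → X, IsIsocausalOn T d γ S →
      ∀ bk : ℕ → ℝ, (∀ k, bk k ∈ S) →
      Filter.Tendsto (fun k => (bk k : EReal)) Filter.atTop (𝓝 b) →
      ∀ p : X, (letI := T; Filter.Tendsto (fun k => γ (bk k)) Filter.atTop (𝓝 p)) →
      (letI := T; Filter.Tendsto γ
        (Filter.comap (fun t : ℝ => (t : EReal)) (𝓝[<] b)) (𝓝 p))) ∧
    (∀ (a : EReal) (S : Set ℝ),
      ((∃ b : ℝ, a < (b : EReal) ∧ S = {t : ℝ | a < (t : EReal) ∧ t < b}) ∨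
        (a < (0 : EReal) ∧ S = {t : ℝ | a < (t : EReal) ∧ t ≤ 0})) →
      ∀ γ : ℝ → X, IsIsocausalOn T d γ S →
      ∀ ak : ℕ → ℝ, (∀ k, ak k ∈ S) →
      Filter.Tendsto (fun k => (ak k : EReal)) Filter.atTop (𝓝 a) →
      ∀ p : X, (letI := T; Filter.Tendsto (fun k => γ (ak k)) Filter.atTop (𝓝 p)) →
      (letI := T; Filter.Tendsto γ
        (Filter.comap (fun t : ℝ => (t : EReal)) (𝓝[>] a)) (𝓝 p))) := by
  obtain ⟨hcont, -⟩ := h.2.2.1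
  have hcl : ∀ x, Continuous fun y => d x y := fun x =>
    hcont.comp (continuous_const.prodMk continuous_id)
  have hcr : ∀ x, Continuous fun y => d y x := fun x =>
    hcont.comp (continuous_id.prodMk continuous_const)
  refine ⟨fun b S hS γ hγ u huS hub p hp => ?_, fun a S hS γ hγ u huS hua p hp => ?_⟩
  · have hlt : ∀ t ∈ S, (t : EReal) < b := by
      rcases hS with ⟨a, -, rfl⟩ | ⟨-, rfl⟩ <;> exact fun t ht => ht.2
    have hev : ∀ c : ℝ, (c : EReal) < b →
        ∀ᶠ t : ℝ in comap (fun t : ℝ => (t : EReal)) (𝓝[<] b), c < t ∧ (t : EReal) < b :=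
      fun c hc => mem_of_superset (preimage_mem_comap (Ioo_mem_nhdsLT hc))
        fun t ht => ⟨EReal.coe_lt_coe_iff.1 ht.1, ht.2⟩
    have hSl : S ∈ comap (fun t : ℝ => (t : EReal)) (𝓝[<] b) := by
      rcases hS with ⟨a, hab, rfl⟩ | ⟨hb, rfl⟩
      · exact hev a hab
      · exact (hev 0 hb).mono fun t ht => ⟨ht.1.le, ht.2⟩
    have hul : ∀ k, ∀ᶠ t in comap (fun t : ℝ => (t : EReal)) (𝓝[<] b), u k ≤ t := fun k =>
      (hev (u k) (hlt _ (huS k))).mono fun t ht => ht.1.le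
    have hlu : ∀ᶠ t in comap (fun t : ℝ => (t : EReal)) (𝓝[<] b), ∀ᶠ k in atTop, t ≤ u k := by
      filter_upwards [hSl] with t ht
      exact (hub.eventually_const_lt (hlt t ht)).mono fun k hk => (EReal.coe_lt_coe_iff.1 hk).le
    refine h.le_nhds_of_tendsto_dist hnb (fun x => tendsto_map'_iff.2 ?_)
      (fun x => tendsto_map'_iff.2 ?_)
    · exact (hγ.monotoneOn_dist_left x).tendsto_of_cofinal_seq hSl huS hul hlu
        (((hcl x).tendsto p).comp hp)
    · exact (hγ.antitoneOn_dist_right x).dual_right.tendsto_of_cofinal_seq hSl huS hul hlu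
        (((hcr x).tendsto p).comp hp)
  · have hlt : ∀ t ∈ S, a < (t : EReal) := by
      rcases hS with ⟨b, -, rfl⟩ | ⟨-, rfl⟩ <;> exact fun t ht => ht.1
    have hev : ∀ c : ℝ, a < (c : EReal) →
        ∀ᶠ t : ℝ in comap (fun t : ℝ => (t : EReal)) (𝓝[>] a), a < (t : EReal) ∧ t < c :=
      fun c hc => mem_of_superset (preimage_mem_comap (Ioo_mem_nhdsGT hc))
        fun t ht => ⟨ht.1, EReal.coe_lt_coe_iff.1 ht.2⟩
    have hSl : S ∈ comap (fun t : ℝ => (t : EReal)) (𝓝[>] a) := by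
      rcases hS with ⟨b, hab, rfl⟩ | ⟨ha, rfl⟩
      · exact hev b hab
      · exact (hev 0 ha).mono fun t ht => ⟨ht.1, ht.2.le⟩
    have hul : ∀ k, ∀ᶠ t in comap (fun t : ℝ => (t : EReal)) (𝓝[>] a), t ≤ u k := fun k =>
      (hev (u k) (hlt _ (huS k))).mono fun t ht => ht.2.le
    have hlu : ∀ᶠ t in comap (fun t : ℝ => (t : EReal)) (𝓝[>] a), ∀ᶠ k in atTop, u k ≤ t := by
      filter_upwards [hSl] with t ht
      exact (hua.eventually_lt_const (hlt t ht)).mono fun k hk => (EReal.coe_lt_coe_iff.1 hk).le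
    refine h.le_nhds_of_tendsto_dist hnb (fun x => tendsto_map'_iff.2 ?_)
      (fun x => tendsto_map'_iff.2 ?_)
    · exact (hγ.monotoneOn_dist_left x).dual.tendsto_of_cofinal_seq (α := ℝᵒᵈ) hSl huS hul hlu
        (((hcl x).tendsto p).comp hp)
    · exact (hγ.antitoneOn_dist_right x).dual_left.tendsto_of_cofinal_seq (α := ℝᵒᵈ)
        hSl huS hul hlu (((hcr x).tendsto p).comp hp)
end

section
/- Every countably generated Lorentzian metric space (X,d) admits a Cauchy time function τ : X → ℝ; moreover τ can be chosen rushing, i.e. such that τ(x) + d(x,y) ≤ τ(y) whenever x ≤ y. Here a Cauchy time function is a time function τ such that for every future inextendible isocausal curve γ : [0,b) → X one has τ(γ(t)) → +∞ as t → b⁻, and for every past inextendible isocausal curve γ : (a,0] → X one has τ(γ(t)) → −∞ as t → a⁺. -/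
open Filter Topology Set

variable {X : Type*}

/-- The Lorentzian distance of the time-reversed space. -/
def revDist (d : X → X → ℝ) (x y : X) : ℝ := d y x

theorem Jrel.revDist {d : X → X → ℝ} {x y : X} (h : Jrel d x y) : Jrel (revDist d) y x :=
  fun p => ⟨(h p).2, (h p).1⟩

theorem IsLMS.revDist [T : TopologicalSpace X] {d : X → X → ℝ} (h : IsLMS T d) :
    IsLMS T (revDist d) := by
  obtain ⟨h0, h1, ⟨hc, hK⟩, h3⟩ := h
  refine ⟨fun x y => h0 y x, fun x y z hxy hyz => ?_, ⟨hc.comp continuous_swap, ?_⟩, ?_⟩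
  · have := h1 z y x hyz hxy
    simp only [_root_.revDist]
    linarith
  · intro x y ε hε
    convert (hK y x ε hε).image continuous_swap using 1
    rw [image_swap_eq_preimage_swap]
    ext ⟨u, v⟩
    simp only [_root_.revDist, mem_inter_iff, mem_ofPred_eq, mem_prod, mem_preimage, Prod.swap,
      and_comm]
  · intro x y hxy
    obtain ⟨z, hz⟩ := h3 x y hxy
    exact ⟨z, hz.symm⟩

/-- Reverse triangle inequality for a chronological pair preceding an arbitrary point. -/
theorem IsLMS.dist_le_of_pos [T : TopologicalSpace X] {d : X → X → ℝ} (h : IsLMS T d)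
    {p x : X} (hpx : 0 < d p x) (q : X) : d x q ≤ d p q := by
  rcases (h.1 x q).lt_or_eq with hq | hq
  · linarith [h.2.1 p x q hpx hq]
  · rw [← hq]; exact h.1 p q

/-- On a chronological diamond, the functions `d(·, z)` are approximated uniformly up to `ε` by
finitely many of them. -/
theorem IsLMS.exists_finite_approx [T : TopologicalSpace X] {d : X → X → ℝ} (h : IsLMS T d)
    (p q : X) {ε : ℝ} (hε : 0 < ε) :
    ∃ S : Set X, S.Finite ∧ ∀ z, 0 < d p z → 0 < d z q →
      (∃ x, 0 < d p x ∧ 0 < d x q ∧ ε ≤ d x z) →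
      ∃ s ∈ S, ∀ x, 0 < d p x → 0 < d x q → |d x z - d x s| < ε := by
  obtain ⟨h0, -, ⟨hc, hK⟩, -⟩ := h
  set A : Set X := {z : X | 0 < d p z ∧ 0 < d z q} with hA
  have hcomp := hK p q ε hε
  rw [← hA] at hcomp
  set K : Set (X × X) := {p : X × X | ε ≤ d p.1 p.2} ∩ (closure A ×ˢ closure A) with hKdef
  have hQ : IsCompact (Prod.fst '' K) := hcomp.image continuous_fst
  have hP : IsCompact (Prod.snd '' K) := hcomp.image continuous_snd
  obtain ⟨t, htP, ht⟩ := hP.elim_nhds_subcover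
    (fun s => {z | ∀ x ∈ Prod.fst '' K, |d x z - d x s| < ε}) (fun s _ => by
      refine hQ.eventually_forall_of_forall_eventually fun x _ => ?_
      have hcont : Continuous fun w : X × X => |d w.2 w.1 - d w.2 s| :=
        ((hc.comp continuous_swap).sub
          (hc.comp (continuous_snd.prodMk continuous_const))).abs
      exact hcont.continuousAt.eventually_lt continuousAt_const (by simpa using hε))
  refine ⟨t, t.finite_toSet, fun z hpz hzq ⟨x, hpx, hxq, hxz⟩ => ?_⟩
  have hmem {y : X} (h1 : 0 < d p y) (h2 : 0 < d y q) : y ∈ closure A := subset_closure ⟨h1, h2⟩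
  have hz : z ∈ Prod.snd '' K := ⟨(x, z), ⟨hxz, hmem hpx hxq, hmem hpz hzq⟩, rfl⟩
  obtain ⟨s, hs, hzs⟩ := mem_iUnion₂.1 (ht hz)
  refine ⟨s, hs, fun y hpy hyq => ?_⟩
  by_cases hy : y ∈ Prod.fst '' K
  · exact hzs y hy
  have hlt : ∀ w ∈ closure A, d y w < ε := fun w hw => by
    by_contra! hle
    exact hy ⟨(y, w), ⟨hle, hmem hpy hyq, hw⟩, rfl⟩
  obtain ⟨⟨u, v⟩, ⟨-, -, hv⟩, rfl⟩ := htP s hs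
  rw [abs_lt]
  constructor <;> linarith [hlt z (hmem hpz hzq), hlt _ hv, h0 y z, h0 y v]

/-- In a countably generated space, countably many functions `d(·, s)` suffice to distinguish
causally related points which are distinguished by some `d(·, z)`. -/
theorem IsLMS.exists_countable_separating [T : TopologicalSpace X] {d : X → X → ℝ}
    (h : IsLMS T d) {G : Set X} (hG : G.Countable)
    (hgen : ∀ x : X, (∃ p ∈ G, 0 < d p x) ∧ (∃ q ∈ G, 0 < d x q)) :
    ∃ E : Set X, E.Countable ∧ G ⊆ E ∧
      ∀ x y z, Jrel d x y → d y z < d x z → ∃ s ∈ E, d y s < d x s := by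
  choose S hSfin hS using fun (p q : X) (n : ℕ) =>
    h.exists_finite_approx p q (Nat.one_div_pos_of_nat (α := ℝ) (n := n))
  refine ⟨G ∪ ⋃ p ∈ G, ⋃ q ∈ G, ⋃ n, S p q n, hG.union (hG.biUnion fun p _ =>
    hG.biUnion fun q _ => countable_iUnion fun n => (hSfin p q n).countable),
    subset_union_left, fun x y z hxy hz => ?_⟩
  have hxz : 0 < d x z := (h.1 y z).trans_lt hz
  obtain ⟨p, hp, hpx⟩ := (hgen x).1
  obtain ⟨q, hq, hzq⟩ := (hgen z).2
  have hxq : 0 < d x q := by linarith [h.2.1 x z q hxz hzq]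
  have hpz : 0 < d p z := by linarith [h.2.1 p x z hpx hxz]
  have hpy : 0 < d p y := hpx.trans_le (hxy p).1
  rcases (h.1 y q).lt_or_eq with hyq | hyq
  · obtain ⟨n, hn⟩ := exists_nat_one_div_lt (show 0 < (d x z - d y z) / 2 by linarith)
    obtain ⟨s, hs, hsx⟩ := hS p q n z hpz hzq ⟨x, hpx, hxq, by linarith [h.1 y z]⟩
    refine ⟨s, Or.inr ?_, ?_⟩
    · simp only [mem_iUnion]
      exact ⟨p, hp, q, hq, n, hs⟩
    · have h1 := abs_lt.1 (hsx x hpx hxq)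
      have h2 := abs_lt.1 (hsx y hpy hyq)
      linarith [h1.2, h2.1]
  · exact ⟨q, Or.inl hq, hyq ▸ hxq⟩

/-- The weight of the `n`-th generator in `volSum`. -/
noncomputable def volWeight (d : X → X → ℝ) (e : ℕ → X) (n : ℕ) : ℝ :=
  (1 / 2) ^ n * Real.exp (-∑ i ∈ Finset.range (n + 1), d (e i) (e n))

/-- The `n`-th term of `volSum`. -/
noncomputable def volTerm (d : X → X → ℝ) (e : ℕ → X) (n : ℕ) (x : X) : ℝ :=
  volWeight d e n * (Real.exp (d x (e n)) - 1)

/-- A weighted sum which plays the role of the volume of the future of `x`. -/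
noncomputable def volSum (d : X → X → ℝ) (e : ℕ → X) (x : X) : ℝ := ∑' n, volTerm d e n x

theorem volWeight_pos (d : X → X → ℝ) (e : ℕ → X) (n : ℕ) : 0 < volWeight d e n := by
  unfold volWeight
  positivity

theorem volTerm_anti {d : X → X → ℝ} {e : ℕ → X} {x y : X} (hxy : Jrel d x y) (n : ℕ) :
    volTerm d e n y ≤ volTerm d e n x :=
  mul_le_mul_of_nonneg_left (sub_le_sub_right (Real.exp_le_exp.2 (hxy _).2) _)
    (volWeight_pos d e n).le

section volSum

variable [T : TopologicalSpace X] {d : X → X → ℝ} {e : ℕ → X}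

theorem IsLMS.volTerm_nonneg (h : IsLMS T d) (n : ℕ) (x : X) : 0 ≤ volTerm d e n x :=
  mul_nonneg (volWeight_pos d e n).le (sub_nonneg.2 (Real.one_le_exp (h.1 _ _)))

theorem IsLMS.volTerm_le (h : IsLMS T d) {i : ℕ} {x : X} (hx : 0 < d (e i) x) (n : ℕ) :
    volTerm d e n x ≤ volWeight d e n * Real.exp (d (e i) (e n)) := by
  refine mul_le_mul_of_nonneg_left ?_ (volWeight_pos d e n).le
  linarith [Real.exp_le_exp.2 (h.dist_le_of_pos hx (e n))]

theorem IsLMS.summable_volWeight_mul_exp (h : IsLMS T d) (i : ℕ) :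
    Summable fun n => volWeight d e n * Real.exp (d (e i) (e n)) := by
  refine Summable.of_norm_bounded_eventually_nat (g := fun n : ℕ => (1 / 2 : ℝ) ^ n)
    (summable_geometric_of_lt_one (by norm_num) (by norm_num)) ?_
  filter_upwards [eventually_ge_atTop i] with n hn
  rw [Real.norm_of_nonneg (mul_nonneg (volWeight_pos d e n).le (Real.exp_pos _).le), volWeight,
    mul_assoc, ← Real.exp_add]
  refine mul_le_of_le_one_right (by positivity) (Real.exp_le_one_iff.2 ?_)
  have := Finset.single_le_sum (f := fun j => d (e j) (e n)) (fun j _ => h.1 _ _)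
    (Finset.mem_range.2 (Nat.lt_succ_of_le hn))
  linarith

theorem IsLMS.summable_volTerm (h : IsLMS T d) (hp : ∀ x, ∃ n, 0 < d (e n) x) (x : X) :
    Summable fun n => volTerm d e n x := by
  obtain ⟨i, hi⟩ := hp x
  exact Summable.of_nonneg_of_le (fun n => h.volTerm_nonneg n x) (fun n => h.volTerm_le hi n)
    (h.summable_volWeight_mul_exp i)

theorem IsLMS.continuous_volSum (h : IsLMS T d) (hp : ∀ x, ∃ n, 0 < d (e n) x) :
    Continuous (volSum d e) := by
  have hc : Continuous fun p : X × X => d p.1 p.2 := h.2.2.1.1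
  refine continuous_iff_continuousAt.2 fun x => ?_
  obtain ⟨i, hi⟩ := hp x
  have hopen : IsOpen {y | 0 < d (e i) y} :=
    isOpen_lt continuous_const (hc.comp (continuous_const.prodMk continuous_id))
  refine ContinuousOn.continuousAt (s := {y | 0 < d (e i) y}) ?_ (hopen.mem_nhds hi)
  refine continuousOn_tsum (fun n => Continuous.continuousOn ?_)
    (h.summable_volWeight_mul_exp (e := e) i) fun n y hy => ?_
  · exact continuous_const.mul
      ((Real.continuous_exp.comp (hc.comp (continuous_id.prodMk continuous_const))).sub
        continuous_const)
  · rw [Real.norm_of_nonneg (h.volTerm_nonneg n y)]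
    exact h.volTerm_le hy n

theorem IsLMS.volSum_pos (h : IsLMS T d) (hp : ∀ x, ∃ n, 0 < d (e n) x) {x : X}
    (hq : ∃ n, 0 < d x (e n)) : 0 < volSum d e x := by
  obtain ⟨n, hn⟩ := hq
  refine (h.summable_volTerm hp x).tsum_pos (fun n => h.volTerm_nonneg n x) n ?_
  exact mul_pos (volWeight_pos d e n) (sub_pos.2 (Real.one_lt_exp_iff.2 hn))

theorem IsLMS.exp_mul_volTerm_le (h : IsLMS T d) {x y : X} (hxy : Jrel d x y) (n : ℕ) :
    Real.exp (d x y) * volTerm d e n y ≤ volTerm d e n x := by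
  unfold volTerm
  rw [mul_left_comm]
  refine mul_le_mul_of_nonneg_left ?_ (volWeight_pos d e n).le
  rcases (h.1 y (e n)).lt_or_eq with hy | hy
  · have hle : d x y + d y (e n) ≤ d x (e n) := by
      rcases (h.1 x y).lt_or_eq with h1 | h1
      · exact h.2.1 _ _ _ h1 hy
      · rw [← h1, zero_add]; exact (hxy _).2
    have h1 := Real.exp_le_exp.2 hle
    rw [Real.exp_add] at h1
    linarith [Real.one_le_exp (h.1 x y)]
  · rw [← hy, Real.exp_zero, sub_self, mul_zero]
    exact sub_nonneg.2 (Real.one_le_exp (h.1 _ _))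

theorem IsLMS.exp_mul_volSum_le (h : IsLMS T d) (hp : ∀ x, ∃ n, 0 < d (e n) x) {x y : X}
    (hxy : Jrel d x y) : Real.exp (d x y) * volSum d e y ≤ volSum d e x := by
  unfold volSum
  rw [← tsum_mul_left]
  exact ((h.summable_volTerm hp y).mul_left _).tsum_le_tsum (h.exp_mul_volTerm_le hxy)
    (h.summable_volTerm hp x)

theorem IsLMS.volSum_lt (h : IsLMS T d) (hp : ∀ x, ∃ n, 0 < d (e n) x) {x y : X}
    (hxy : Jrel d x y) (hn : ∃ n, d y (e n) < d x (e n)) : volSum d e y < volSum d e x := by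
  obtain ⟨n, hn⟩ := hn
  refine (h.summable_volTerm hp y).tsum_lt_tsum (i := n) (volTerm_anti hxy) ?_
    (h.summable_volTerm hp x)
  exact mul_lt_mul_of_pos_left (sub_lt_sub_right (Real.exp_lt_exp.2 hn) _) (volWeight_pos d e n)

end volSum

section Inextendible

variable [T : TopologicalSpace X] {d : X → X → ℝ} {ι : Type*} {l : Filter ι} {γ : ι → X}
  {S : Set ι}

theorem MapClusterPt.le_of_eventually_le {f : X → ℝ} {u v : X}
    (hf : Continuous f) (hu : MapClusterPt u l γ) (hv : MapClusterPt v l γ)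
    (hS : ∀ᶠ t in l, t ∈ S) (hmono : ∀ s ∈ S, ∀ᶠ t in l, f (γ s) ≤ f (γ t)) : f u ≤ f v :=
  (isClosed_le hf continuous_const).mem_of_mapClusterPt hu <| hS.mono fun s hs =>
    (isClosed_le continuous_const hf).mem_of_mapClusterPt hv (hmono s hs)

/-- An eventually causal family has at most one cluster point. -/
theorem IsLMS.mapClusterPt_unique (h : IsLMS T d) (hS : ∀ᶠ t in l, t ∈ S)
    (hJ : ∀ s ∈ S, ∀ᶠ t in l, Jrel d (γ s) (γ t)) {u v : X}
    (hu : MapClusterPt u l γ) (hv : MapClusterPt v l γ) : u = v := by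
  have hc : Continuous fun p : X × X => d p.1 p.2 := h.2.2.1.1
  have key : ∀ u v : X, MapClusterPt u l γ → MapClusterPt v l γ →
      ∀ z, d z u ≤ d z v ∧ d v z ≤ d u z := fun u v hu hv z => by
    refine ⟨hu.le_of_eventually_le (f := fun x => d z x)
      (hc.comp (continuous_const.prodMk continuous_id)) hv hS fun s hs =>
        (hJ s hs).mono fun t ht => (ht z).1, neg_le_neg_iff.1 ?_⟩
    exact hu.le_of_eventually_le (f := fun x => -d x z)
      (hc.comp (continuous_id.prodMk continuous_const)).neg hv hS fun s hs =>
        (hJ s hs).mono fun t ht => neg_le_neg (ht z).2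
  by_contra hne
  obtain ⟨z, hz | hz⟩ := h.2.2.2 u v hne
  · exact hz (le_antisymm (key v u hv hu z).2 (key u v hu hv z).2)
  · exact hz (le_antisymm (key u v hu hv z).1 (key v u hv hu z).1)

/-- Along an eventually causal family without limit, the distance to any point tends to zero. -/
theorem IsLMS.tendsto_dist_zero (h : IsLMS T d) (hb : NoBoundary d) [l.NeBot]
    (hS : ∀ᶠ t in l, t ∈ S) (hJ : ∀ s ∈ S, ∀ᶠ t in l, Jrel d (γ s) (γ t))
    (hlim : ¬∃ p, Tendsto γ l (𝓝 p)) (q : X) : Tendsto (fun t => d (γ t) q) l (𝓝 0) := by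
  by_cases hsmall : ∀ ε > 0, ∃ s ∈ S, d (γ s) q < ε
  · refine tendsto_order.2 ⟨fun a ha => Eventually.of_forall fun t => ha.trans_le (h.1 _ _),
      fun ε hε => ?_⟩
    obtain ⟨s, hs, hlt⟩ := hsmall ε hε
    exact (hJ s hs).mono fun t ht => (ht q).2.trans_lt hlt
  push Not at hsmall
  obtain ⟨ε, hε, hle⟩ := hsmall
  obtain ⟨s, hs⟩ := hS.exists
  obtain ⟨p, hp⟩ := (hb (γ s)).1
  obtain ⟨p', hp'⟩ := (hb p).1
  obtain ⟨q', hq'⟩ := (hb q).2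
  have hcomp := (h.2.2.1.2 p' q' ε hε).image continuous_fst
  refine absurd ?_ hlim
  have hmem : ∀ᶠ t in l, γ t ∈ Prod.fst '' ({p : X × X | ε ≤ d p.1 p.2} ∩
      (closure {z : X | 0 < d p' z ∧ 0 < d z q'} ×ˢ
        closure {z : X | 0 < d p' z ∧ 0 < d z q'})) := by
    filter_upwards [hJ s hs, hS] with t ht htS
    have hpt : 0 < d p (γ t) := hp.trans_le (ht p).1
    have htq : 0 < d (γ t) q := hε.trans_le (hle t htS)
    have hpt' : 0 < d p' (γ t) := by linarith [h.2.1 _ _ _ hp' hpt]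
    have htq' : 0 < d (γ t) q' := by linarith [h.2.1 _ _ _ htq hq']
    have hpq' : 0 < d p' q := by linarith [h.2.1 _ _ _ hpt' htq]
    exact ⟨(γ t, q), ⟨hle t htS, subset_closure ⟨hpt', htq'⟩, subset_closure ⟨hpq', hq'⟩⟩, rfl⟩
  obtain ⟨u, -, hu⟩ := hcomp.exists_mapClusterPt_of_frequently hmem.frequently
  exact ⟨u, hcomp.tendsto_nhds_of_unique_mapClusterPt hmem fun v _ hv =>
    h.mapClusterPt_unique hS hJ hv hu⟩

theorem IsLMS.tendsto_log_volSum {e : ℕ → X} (h : IsLMS T d)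
    (hp : ∀ x, ∃ n, 0 < d (e n) x) (hq : ∀ x, ∃ n, 0 < d x (e n))
    (hS : ∀ᶠ t in l, t ∈ S) (hJ : ∀ s ∈ S, ∀ᶠ t in l, Jrel d (γ s) (γ t))
    (hlim : ¬∃ p, Tendsto γ l (𝓝 p)) :
    Tendsto (fun t => Real.log (volSum d e (γ t))) l atBot := by
  rcases l.eq_or_neBot with rfl | hl
  · exact tendsto_bot
  have hb : NoBoundary d := fun x => ⟨(hp x).imp' e fun _ => id, (hq x).imp' e fun _ => id⟩
  obtain ⟨s, hs⟩ := hS.exists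
  refine Real.tendsto_log_nhdsGT_zero.comp (tendsto_nhdsWithin_iff.2 ⟨?_,
    Eventually.of_forall fun t => h.volSum_pos hp (hq _)⟩)
  rw [← tsum_zero (α := ℝ) (β := ℕ)]
  refine tendsto_tsum_of_dominated_convergence (h.summable_volTerm hp (γ s)) (fun n => ?_) ?_
  · have hexp := (Real.continuous_exp.tendsto 0).comp (h.tendsto_dist_zero hb hS hJ hlim (e n))
    simpa [volTerm, Function.comp_def] using (hexp.sub_const 1).const_mul (volWeight d e n)
  · filter_upwards [hJ s hs] with t ht n
    rw [Real.norm_of_nonneg (h.volTerm_nonneg n _)]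
    exact volTerm_anti ht n

end Inextendible

/-- The logarithmic ratio of the past and future volume functions. -/
noncomputable def geroch (d : X → X → ℝ) (e : ℕ → X) (x : X) : ℝ :=
  Real.log (volSum (revDist d) e x) - Real.log (volSum d e x)

theorem geroch_revDist (d : X → X → ℝ) (e : ℕ → X) (x : X) : geroch (revDist d) e x = -geroch d e x :=
  (neg_sub _ _).symm

section Geroch

variable [T : TopologicalSpace X] {d : X → X → ℝ} {e : ℕ → X}

theorem IsLMS.log_volSum_add_le (h : IsLMS T d) (hp : ∀ x, ∃ n, 0 < d (e n) x)
    (hq : ∀ x, ∃ n, 0 < d x (e n)) {x y : X} (hxy : Jrel d x y) :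
    d x y + Real.log (volSum d e y) ≤ Real.log (volSum d e x) := by
  have hy := h.volSum_pos hp (hq y)
  rw [← Real.log_exp (d x y), ← Real.log_mul (Real.exp_pos _).ne' hy.ne']
  exact Real.log_le_log (by positivity) (h.exp_mul_volSum_le hp hxy)

theorem IsLMS.tendsto_geroch {ι : Type*} {l : Filter ι} {γ : ι → X} {S : Set ι}
    (h : IsLMS T d) (hp : ∀ x, ∃ n, 0 < d (e n) x) (hq : ∀ x, ∃ n, 0 < d x (e n))
    (hS : ∀ᶠ t in l, t ∈ S) (hJ : ∀ s ∈ S, ∀ᶠ t in l, Jrel d (γ s) (γ t))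
    (hlim : ¬∃ p, Tendsto γ l (𝓝 p)) : Tendsto (fun t => geroch d e (γ t)) l atTop := by
  rcases l.eq_or_neBot with rfl | hl
  · exact tendsto_bot
  obtain ⟨s, hs⟩ := hS.exists
  have hlog := tendsto_neg_atBot_atTop.comp (h.tendsto_log_volSum hp hq hS hJ hlim)
  refine tendsto_atTop_add_left_of_le' l (Real.log (volSum (_root_.revDist d) e (γ s))) ?_ hlog
  filter_upwards [hJ s hs] with t ht
  have := h.revDist.log_volSum_add_le hq hp ht.revDist
  linarith [h.1 (γ s) (γ t), show _root_.revDist d (γ t) (γ s) = d (γ s) (γ t) from rfl]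

end Geroch

/-- Every countably generated Lorentzian metric space admits a Cauchy time
function, which moreover can be chosen rushing
(`τ(x) + d(x,y) ≤ τ(y)` whenever `x ≤ y`). -/
theorem lms_cauchy_time_function
    (T : TopologicalSpace X) (d : X → X → ℝ)
    (h : IsLMS T d) (hcg : CountablyGenerated d) :
    ∃ τ : X → ℝ, IsTimeFunction T d τ ∧
      (∀ x y : X, Jrel d x y → τ x + d x y ≤ τ y) ∧
      (∀ b : EReal, (0 : EReal) < b →
        ∀ γ : ℝ → X, IsIsocausalOn T d γ {t : ℝ | 0 ≤ t ∧ (t : EReal) < b} →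
        (letI := T; ¬∃ p : X, Filter.Tendsto γ
          (Filter.comap (fun t : ℝ => (t : EReal)) (𝓝[<] b)) (𝓝 p)) →
        Filter.Tendsto (fun t => τ (γ t))
          (Filter.comap (fun t : ℝ => (t : EReal)) (𝓝[<] b)) Filter.atTop) ∧
      (∀ a : EReal, a < (0 : EReal) →
        ∀ γ : ℝ → X, IsIsocausalOn T d γ {t : ℝ | a < (t : EReal) ∧ t ≤ 0} →
        (letI := T; ¬∃ p : X, Filter.Tendsto γ
          (Filter.comap (fun t : ℝ => (t : EReal)) (𝓝[>] a)) (𝓝 p)) →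
        Filter.Tendsto (fun t => τ (γ t))
          (Filter.comap (fun t : ℝ => (t : EReal)) (𝓝[>] a)) Filter.atBot) := by
  obtain ⟨G, hGc, hG⟩ := hcg
  obtain ⟨E, hE, hGE, hEsep⟩ := h.exists_countable_separating hGc hG
  obtain ⟨E', hE', -, hEsep'⟩ := h.revDist.exists_countable_separating hGc fun x => (hG x).symm
  rcases isEmpty_or_nonempty X with hX | ⟨⟨x₀⟩⟩
  · exact ⟨fun _ => 0, ⟨continuous_const, fun x => hX.elim x⟩, fun x => hX.elim x,
      fun _ _ γ => hX.elim (γ 0), fun _ _ γ => hX.elim (γ 0)⟩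
  have hne : (E ∪ E').Nonempty := by
    obtain ⟨p, hp, -⟩ := (hG x₀).1
    exact ⟨p, Or.inl (hGE hp)⟩
  obtain ⟨e, he⟩ := (hE.union hE').exists_eq_range hne
  have hidx : ∀ s, s ∈ E ∨ s ∈ E' → ∃ n, e n = s := fun s hs => by
    have : s ∈ E ∪ E' := hs
    rwa [he] at this
  have hp : ∀ x, ∃ n, 0 < d (e n) x := fun x => by
    obtain ⟨p, hp, hpx⟩ := (hG x).1
    obtain ⟨n, rfl⟩ := hidx p (Or.inl (hGE hp))
    exact ⟨n, hpx⟩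
  have hq : ∀ x, ∃ n, 0 < d x (e n) := fun x => by
    obtain ⟨q, hq, hxq⟩ := (hG x).2
    obtain ⟨n, rfl⟩ := hidx q (Or.inl (hGE hq))
    exact ⟨n, hxq⟩
  have hpos : ∀ x, 0 < volSum d e x := fun x => h.volSum_pos hp (hq x)
  have hpos' : ∀ x, 0 < volSum (revDist d) e x := fun x => h.revDist.volSum_pos hq (hp x)
  refine ⟨geroch d e, ⟨?_, fun x y hxy => ?_⟩, fun x y hxy => ?_,
    fun b hb γ hγ hlim => ?_, fun a ha γ hγ hlim => ?_⟩
  · exact ((h.revDist.continuous_volSum hq).log fun x => (hpos' x).ne').sub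
      ((h.continuous_volSum hp).log fun x => (hpos x).ne')
  · have hle := h.log_volSum_add_le hp hq hxy.1
    have hle' := h.revDist.log_volSum_add_le hq hp hxy.1.revDist
    have h0 := h.1 x y
    have h0' := h.revDist.1 y x
    have hz : (∃ z, d y z < d x z) ∨ ∃ z, revDist d x z < revDist d y z := by
      obtain ⟨z, hz | hz⟩ := h.2.2.2 x y hxy.2
      · exact Or.inl ⟨z, (hxy.1 z).2.lt_of_ne' hz⟩
      · exact Or.inr ⟨z, (hxy.1 z).1.lt_of_ne hz⟩
    unfold geroch
    rcases hz with ⟨z, hz⟩ | ⟨z, hz⟩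
    · obtain ⟨s, hs, hlt⟩ := hEsep x y z hxy.1 hz
      obtain ⟨n, rfl⟩ := hidx s (Or.inl hs)
      linarith [Real.log_lt_log (hpos y) (h.volSum_lt hp hxy.1 ⟨n, hlt⟩)]
    · obtain ⟨s, hs, hlt⟩ := hEsep' y x z hxy.1.revDist hz
      obtain ⟨n, rfl⟩ := hidx s (Or.inr hs)
      linarith [Real.log_lt_log (hpos' x) (h.revDist.volSum_lt hq hxy.1.revDist ⟨n, hlt⟩)]
  · have hle := h.log_volSum_add_le hp hq hxy
    have hle' := h.revDist.log_volSum_add_le hq hp hxy.revDist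
    unfold geroch
    linarith [h.revDist.1 y x]
  · refine h.tendsto_geroch (S := {t : ℝ | 0 ≤ t ∧ (t : EReal) < b}) hp hq ?_ ?_ hlim
    · filter_upwards [preimage_mem_comap (Ioo_mem_nhdsLT hb)] with t ht
      exact ⟨EReal.coe_nonneg.1 ht.1.le, ht.2⟩
    · intro s hs
      filter_upwards [preimage_mem_comap (Ioo_mem_nhdsLT hs.2)] with t ht
      have hst : s < t := EReal.coe_lt_coe_iff.1 ht.1
      exact (hγ.2 s hs t ⟨hs.1.trans hst.le, ht.2⟩ hst).1
  · have key := h.revDist.tendsto_geroch (S := {t : ℝ | a < (t : EReal) ∧ t ≤ 0}) hq hp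
      (l := comap (fun t : ℝ => (t : EReal)) (𝓝[>] a)) (γ := γ) ?_ ?_ hlim
    · simp only [geroch_revDist] at key
      exact tendsto_neg_atTop_iff.1 key
    · filter_upwards [preimage_mem_comap (Ioo_mem_nhdsGT ha)] with t ht
      exact ⟨ht.1, EReal.coe_nonpos.1 ht.2.le⟩
    · intro s hs
      filter_upwards [preimage_mem_comap (Ioo_mem_nhdsGT hs.1)] with t ht
      have hts : t < s := EReal.coe_lt_coe_iff.1 ht.2
      exact (hγ.2 t ⟨ht.1, hts.le.trans hs.2⟩ s hs hts).1.revDist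
end
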